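/- arXiv:2107.12505 — 2 statements merged into one kernel-verified Lean document; each statement's English description precedes it below -/
import Mathlib

section
/- Let 0 < λ < 2/81. Then: (i) the matrix-valued function W ↦ Q_λ(W) on ℝ³ is subordinate; (ii) Q_λ is diagonally elliptical, indeed there are 0 < c ≤ C with c|W|²·I₃ ≼ Q_λ(W) ≼ C|W|²·I₃ for all W ∈ ℝ³; and (iii) for every δ > 0 and every ρ > 0, there do not exist finitely many functions u¹, …, u^L : B(0, ρ) ⊂ ℝ³ → ℝ³, each of class C^{1,δ} on B(0, ρ), such that Q_λ(W) = Σ_{ℓ=1}^{L} u^ℓ(W) u^ℓ(W)ᵀ for all W ∈ B(0, ρ). -/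
open Matrix

noncomputable section

abbrev E (M : ℕ) := EuclideanSpace ℝ (Fin M)

noncomputable def Qlam (l x y z : ℝ) : Matrix (Fin 3) (Fin 3) ℝ :=
  !![x ^ 2 + l * y ^ 2 + 2 * z ^ 2, -(x * y), -(x * z);
     -(x * y), y ^ 2 + l * z ^ 2 + 2 * x ^ 2, -(y * z);
     -(x * z), -(y * z), z ^ 2 + l * x ^ 2 + 2 * y ^ 2]

noncomputable def QlamV (l : ℝ) (W : E 3) : Matrix (Fin 3) (Fin 3) ℝ :=
  Qlam l (W 0) (W 1) (W 2)

noncomputable def pdM {M n : ℕ} (k : Fin M) (A : E M → Matrix (Fin n) (Fin n) ℝ)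
    (x : E M) : Matrix (Fin n) (Fin n) ℝ :=
  Matrix.of fun i j => fderiv ℝ (fun y => A y i j) x (EuclideanSpace.single k 1)

def Subordinate {M n : ℕ} (A : E M → Matrix (Fin n) (Fin n) ℝ) : Prop :=
  ∃ Γ : ℝ, 0 < Γ ∧ ∀ (x : E M) (ξ : Fin n → ℝ) (k : Fin M),
    ∑ i, ((pdM k A x) *ᵥ ξ) i ^ 2 ≤ Γ ^ 2 * (ξ ⬝ᵥ (A x) *ᵥ ξ)

def mLE {n : ℕ} (A B : Matrix (Fin n) (Fin n) ℝ) : Prop := (B - A).PosSemidef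

/-- `f` is of class `C^{k,δ}` on the set `U`. -/
def CHolderOn {X F : Type*} [NormedAddCommGroup X] [NormedSpace ℝ X]
    [NormedAddCommGroup F] [NormedSpace ℝ F]
    (k : ℕ) (δ : ℝ) (f : X → F) (U : Set X) : Prop :=
  ContDiffOn ℝ k f U ∧
    ∃ C : NNReal, HolderOnWith C δ.toNNReal (fun x => iteratedFDerivWithin ℝ k f U x) U


lemma amgm_aux {a b c : ℝ} (ha : 0 ≤ a) (hb : 0 ≤ b) (hc : 0 ≤ c) :
    0 ≤ a ^ 2 * b + b ^ 2 * c + c ^ 2 * a - 3 * a * b * c := by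
  have key : ∀ p q r : ℝ, 0 ≤ p → 0 ≤ q → 0 ≤ r →
      0 ≤ (r + p) ^ 2 * (r + q) + (r + q) ^ 2 * r + r ^ 2 * (r + p)
        - 3 * (r + p) * (r + q) * r := by
    intro p q r hp hq hr
    have e : (r + p) ^ 2 * (r + q) + (r + q) ^ 2 * r + r ^ 2 * (r + p)
        - 3 * (r + p) * (r + q) * r = r * ((p - q / 2) ^ 2 + 3 / 4 * q ^ 2) + p ^ 2 * q := by ring
    rw [e]; positivity
  rcases le_total a b with h | h <;> rcases le_total b c with h' | h' <;>
    rcases le_total a c with h'' | h''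
  · have := key (b - a) (c - a) a (by linarith) (by linarith) ha; nlinarith [this]
  · have := key (b - a) (c - a) a (by linarith) (by linarith) ha; nlinarith [this]
  · have := key (b - a) (c - a) a (by linarith) (by linarith) ha; nlinarith [this]
  · have := key (a - c) (b - c) c (by linarith) (by linarith) hc; nlinarith [this]
  · have := key (c - b) (a - b) b (by linarith) (by linarith) hb; nlinarith [this]
  · have := key (c - b) (a - b) b (by linarith) (by linarith) hb; nlinarith [this]
  · have := key (a - c) (b - c) c (by linarith) (by linarith) hc; nlinarith [this]
  · have := key (a - c) (b - c) c (by linarith) (by linarith) hc; nlinarith [this]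

lemma choi_aux (x y z p q r : ℝ) :
    0 ≤ (x ^ 2 + z ^ 2) * p ^ 2 + (y ^ 2 + x ^ 2) * q ^ 2 + (z ^ 2 + y ^ 2) * r ^ 2
      - 2 * (x * y * p * q + x * z * p * r + y * z * q * r) := by
  have hdet := amgm_aux (sq_nonneg x) (sq_nonneg y) (sq_nonneg z)
  rcases (add_nonneg (sq_nonneg x) (sq_nonneg z)).eq_or_lt with h | h
  · have hx : x = 0 := by nlinarith [sq_nonneg x, sq_nonneg z]
    have hz : z = 0 := by nlinarith [sq_nonneg x, sq_nonneg z]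
    subst hx hz
    have : 0 ≤ y ^ 2 * q ^ 2 + y ^ 2 * r ^ 2 := by positivity
    linarith
  · have hA : 0 ≤ x ^ 4 + x ^ 2 * z ^ 2 + y ^ 2 * z ^ 2 := by positivity
    have hquad : 0 ≤ (x ^ 4 + x ^ 2 * z ^ 2 + y ^ 2 * z ^ 2) * q ^ 2
        - 2 * (y * z * (2 * x ^ 2 + z ^ 2)) * q * r
        + (x ^ 2 * y ^ 2 + y ^ 2 * z ^ 2 + z ^ 4) * r ^ 2 := by
      rcases hA.eq_or_lt with h0 | h0
      · have hx4 : x ^ 4 = 0 := by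
          have : 0 ≤ x ^ 4 := by positivity
          have : 0 ≤ x ^ 2 * z ^ 2 := by positivity
          have : 0 ≤ y ^ 2 * z ^ 2 := by positivity
          linarith
        have hx : x = 0 := by simpa using hx4
        subst hx
        have hyz : y * z = 0 := by
          have : (y * z) ^ 2 = 0 := by nlinarith
          simpa using this
        have : 0 ≤ z ^ 4 * r ^ 2 := by positivity
        have e2 : y ^ 2 * z ^ 2 = 0 := by rw [← mul_pow, hyz]; simp
        rw [hyz, e2]; nlinarith
      · refine nonneg_of_mul_nonneg_right ?_ h0
        have e : (x ^ 4 + x ^ 2 * z ^ 2 + y ^ 2 * z ^ 2) *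
          ((x ^ 4 + x ^ 2 * z ^ 2 + y ^ 2 * z ^ 2) * q ^ 2
            - 2 * (y * z * (2 * x ^ 2 + z ^ 2)) * q * r
            + (x ^ 2 * y ^ 2 + y ^ 2 * z ^ 2 + z ^ 4) * r ^ 2)
          = ((x ^ 4 + x ^ 2 * z ^ 2 + y ^ 2 * z ^ 2) * q - y * z * (2 * x ^ 2 + z ^ 2) * r) ^ 2
            + (x ^ 2 + z ^ 2) * ((x ^ 2) ^ 2 * y ^ 2 + (y ^ 2) ^ 2 * z ^ 2 + (z ^ 2) ^ 2 * x ^ 2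
              - 3 * x ^ 2 * y ^ 2 * z ^ 2) * r ^ 2 := by ring
        rw [e]; positivity
    refine nonneg_of_mul_nonneg_right ?_ h
    have e : (x ^ 2 + z ^ 2) * ((x ^ 2 + z ^ 2) * p ^ 2 + (y ^ 2 + x ^ 2) * q ^ 2
          + (z ^ 2 + y ^ 2) * r ^ 2 - 2 * (x * y * p * q + x * z * p * r + y * z * q * r))
        = ((x ^ 2 + z ^ 2) * p - x * y * q - x * z * r) ^ 2
          + ((x ^ 4 + x ^ 2 * z ^ 2 + y ^ 2 * z ^ 2) * q ^ 2
            - 2 * (y * z * (2 * x ^ 2 + z ^ 2)) * q * r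
            + (x ^ 2 * y ^ 2 + y ^ 2 * z ^ 2 + z ^ 4) * r ^ 2) := by ring
    rw [e]; positivity

lemma Q_form (l : ℝ) (W : E 3) (v : Fin 3 → ℝ) :
    v ⬝ᵥ (QlamV l W) *ᵥ v =
      (W 0 ^ 2 + l * W 1 ^ 2 + 2 * W 2 ^ 2) * v 0 ^ 2
      + (W 1 ^ 2 + l * W 2 ^ 2 + 2 * W 0 ^ 2) * v 1 ^ 2
      + (W 2 ^ 2 + l * W 0 ^ 2 + 2 * W 1 ^ 2) * v 2 ^ 2
      - 2 * (W 0 * W 1 * v 0 * v 1 + W 0 * W 2 * v 0 * v 2 + W 1 * W 2 * v 1 * v 2) := by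
  simp [QlamV, Qlam, dotProduct, Matrix.mulVec, Fin.sum_univ_three]
  ring

lemma normsq3 (W : E 3) : ‖W‖ ^ 2 = W 0 ^ 2 + W 1 ^ 2 + W 2 ^ 2 := by
  rw [EuclideanSpace.norm_sq_eq]; simp [Fin.sum_univ_three]

lemma Q_lower {l : ℝ} (h1 : 0 < l) (h2 : l < 2 / 81) (W : E 3) (v : Fin 3 → ℝ) :
    l / 4 * ‖W‖ ^ 2 * (v 0 ^ 2 + v 1 ^ 2 + v 2 ^ 2) ≤ v ⬝ᵥ (QlamV l W) *ᵥ v := by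
  rw [Q_form, normsq3]
  generalize W 0 = x; generalize W 1 = y; generalize W 2 = z
  generalize v 0 = p; generalize v 1 = q; generalize v 2 = r
  have hG := mul_nonneg (show 0 ≤ 1 - l / 4 by linarith) (choi_aux x y z p q r)
  have hs : 0 ≤ l / 4 * ((y * p - x * q) ^ 2 + (z * p - x * r) ^ 2 + (z * q - y * r) ^ 2) := by
    positivity
  have hM : 0 ≤ (l - l / 4 - l / 4) * (y ^ 2 * p ^ 2 + z ^ 2 * q ^ 2 + x ^ 2 * r ^ 2) :=
    mul_nonneg (by linarith) (by positivity)
  have hN : 0 ≤ (1 - l / 4) * (z ^ 2 * p ^ 2 + x ^ 2 * q ^ 2 + y ^ 2 * r ^ 2) :=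
    mul_nonneg (by linarith) (by positivity)
  nlinarith

lemma Q_upper {l : ℝ} (h1 : 0 < l) (h2 : l < 2 / 81) (W : E 3) (v : Fin 3 → ℝ) :
    v ⬝ᵥ (QlamV l W) *ᵥ v ≤ 3 * ‖W‖ ^ 2 * (v 0 ^ 2 + v 1 ^ 2 + v 2 ^ 2) := by
  rw [Q_form, normsq3]
  generalize W 0 = x; generalize W 1 = y; generalize W 2 = z
  generalize v 0 = p; generalize v 1 = q; generalize v 2 = r
  have hs : 0 ≤ ((y * p + x * q) ^ 2 + (z * p + x * r) ^ 2 + (z * q + y * r) ^ 2) := by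
    positivity
  have hM : 0 ≤ (2 - l) * (y ^ 2 * p ^ 2 + z ^ 2 * q ^ 2 + x ^ 2 * r ^ 2) :=
    mul_nonneg (by linarith) (by positivity)
  have hD : 0 ≤ (x ^ 2 * p ^ 2 + y ^ 2 * q ^ 2 + z ^ 2 * r ^ 2) := by positivity
  nlinarith

lemma QlamV_symm (l : ℝ) (W : E 3) : (QlamV l W).IsHermitian := by
  ext i j
  fin_cases i <;> fin_cases j <;> simp [QlamV, Qlam]

lemma one_form (c : ℝ) (v : Fin 3 → ℝ) :
    v ⬝ᵥ (c • (1 : Matrix (Fin 3) (Fin 3) ℝ)) *ᵥ v = c * (v 0 ^ 2 + v 1 ^ 2 + v 2 ^ 2) := by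
  rw [Matrix.smul_mulVec, Matrix.one_mulVec]
  simp [dotProduct, Fin.sum_univ_three]; ring

lemma one_symm (c : ℝ) : (c • (1 : Matrix (Fin 3) (Fin 3) ℝ)).IsHermitian := by
  ext i j
  fin_cases i <;> fin_cases j <;> simp

lemma ell_part {l : ℝ} (h1 : 0 < l) (h2 : l < 2 / 81) (W : E 3) :
    mLE ((l / 4 * ‖W‖ ^ 2) • (1 : Matrix (Fin 3) (Fin 3) ℝ)) (QlamV l W) ∧
      mLE (QlamV l W) ((3 * ‖W‖ ^ 2) • (1 : Matrix (Fin 3) (Fin 3) ℝ)) := by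
  constructor
  · refine Matrix.PosSemidef.of_dotProduct_mulVec_nonneg
      ((QlamV_symm l W).sub (one_symm _)) fun v => ?_
    rw [star_trivial, Matrix.sub_mulVec, dotProduct_sub, one_form]
    linarith [Q_lower h1 h2 W v]
  · refine Matrix.PosSemidef.of_dotProduct_mulVec_nonneg
      ((one_symm _).sub (QlamV_symm l W)) fun v => ?_
    rw [star_trivial, Matrix.sub_mulVec, dotProduct_sub, one_form]
    linarith [Q_upper h1 h2 W v]

lemma fd_aux (a b c d e f : ℝ) (F : E 3 → ℝ) (W v : E 3)
    (hF : ∀ y : E 3, F y = a * y 0 ^ 2 + b * y 1 ^ 2 + c * y 2 ^ 2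
      + d * (y 0 * y 1) + e * (y 0 * y 2) + f * (y 1 * y 2)) :
    fderiv ℝ F W v = 2 * a * W 0 * v 0 + 2 * b * W 1 * v 1 + 2 * c * W 2 * v 2
      + d * (W 0 * v 1 + W 1 * v 0) + e * (W 0 * v 2 + W 2 * v 0)
      + f * (W 1 * v 2 + W 2 * v 1) := by
  have hp : ∀ i : Fin 3, HasFDerivAt (fun y : E 3 => y i)
      (EuclideanSpace.proj i : E 3 →L[ℝ] ℝ) W := fun i =>
    (EuclideanSpace.proj i : E 3 →L[ℝ] ℝ).hasFDerivAt
  obtain rfl : F = _ := funext hF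
  have h := ((((((hp 0).pow 2).const_mul a).add (((hp 1).pow 2).const_mul b)).add
    (((hp 2).pow 2).const_mul c)).add (((hp 0).mul (hp 1)).const_mul d)).add
    (((hp 0).mul (hp 2)).const_mul e) |>.add (((hp 1).mul (hp 2)).const_mul f)
  have h' := h.fderiv
  erw [h']
  simp
  ring

lemma cs3 (a b c p q r : ℝ) :
    (a * p + b * q + c * r) ^ 2 ≤ (a ^ 2 + b ^ 2 + c ^ 2) * (p ^ 2 + q ^ 2 + r ^ 2) := by
  nlinarith [sq_nonneg (a * q - b * p), sq_nonneg (a * r - c * p), sq_nonneg (b * r - c * q)]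

lemma frob_aux (D : Matrix (Fin 3) (Fin 3) ℝ) (v : Fin 3 → ℝ) (K : ℝ)
    (h : D 0 0 ^ 2 + D 0 1 ^ 2 + D 0 2 ^ 2 + (D 1 0 ^ 2 + D 1 1 ^ 2 + D 1 2 ^ 2)
      + (D 2 0 ^ 2 + D 2 1 ^ 2 + D 2 2 ^ 2) ≤ K) :
    ∑ i, (D *ᵥ v) i ^ 2 ≤ K * (v 0 ^ 2 + v 1 ^ 2 + v 2 ^ 2) := by
  have hv : 0 ≤ v 0 ^ 2 + v 1 ^ 2 + v 2 ^ 2 := by positivity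
  refine le_trans ?_ (mul_le_mul_of_nonneg_right h hv)
  simp only [Matrix.mulVec, dotProduct, Fin.sum_univ_three]
  linarith [cs3 (D 0 0) (D 0 1) (D 0 2) (v 0) (v 1) (v 2),
    cs3 (D 1 0) (D 1 1) (D 1 2) (v 0) (v 1) (v 2), cs3 (D 2 0) (D 2 1) (D 2 2) (v 0) (v 1) (v 2)]

lemma sub_part {l : ℝ} (h1 : 0 < l) (h2 : l < 2 / 81) : Subordinate (QlamV l) := by
  have hl2 : l ^ 2 ≤ 1 := by nlinarith
  have hΓ : 0 < 100 / l := by positivity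
  refine ⟨Real.sqrt (100 / l), Real.sqrt_pos.2 hΓ, fun W v k => ?_⟩
  rw [Real.sq_sqrt hΓ.le]
  have hlow := Q_lower h1 h2 W v
  have h3 : 25 * ‖W‖ ^ 2 * (v 0 ^ 2 + v 1 ^ 2 + v 2 ^ 2)
      ≤ 100 / l * (v ⬝ᵥ (QlamV l W) *ᵥ v) := by
    have := mul_le_mul_of_nonneg_left hlow hΓ.le
    refine le_trans (le_of_eq ?_) this
    field_simp; ring
  refine le_trans (frob_aux _ v _ ?_) h3
  simp only [pdM, Matrix.of_apply]
  rw [fd_aux 1 l 2 0 0 0 (fun y : E 3 => QlamV l y 0 0) W _ (by intro y; simp [QlamV, Qlam]),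
    fd_aux 0 0 0 (-1) 0 0 (fun y : E 3 => QlamV l y 0 1) W _ (by intro y; simp [QlamV, Qlam]),
    fd_aux 0 0 0 0 (-1) 0 (fun y : E 3 => QlamV l y 0 2) W _ (by intro y; simp [QlamV, Qlam]),
    fd_aux 0 0 0 (-1) 0 0 (fun y : E 3 => QlamV l y 1 0) W _ (by intro y; simp [QlamV, Qlam]),
    fd_aux 2 1 l 0 0 0 (fun y : E 3 => QlamV l y 1 1) W _
      (by intro y; simp [QlamV, Qlam]; ring),
    fd_aux 0 0 0 0 0 (-1) (fun y : E 3 => QlamV l y 1 2) W _ (by intro y; simp [QlamV, Qlam]),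
    fd_aux 0 0 0 0 (-1) 0 (fun y : E 3 => QlamV l y 2 0) W _ (by intro y; simp [QlamV, Qlam]),
    fd_aux 0 0 0 0 0 (-1) (fun y : E 3 => QlamV l y 2 1) W _ (by intro y; simp [QlamV, Qlam]),
    fd_aux l 2 1 0 0 0 (fun y : E 3 => QlamV l y 2 2) W _
      (by intro y; simp [QlamV, Qlam]; ring), normsq3]
  have hx := mul_le_mul_of_nonneg_right hl2 (sq_nonneg (W 0))
  have hy := mul_le_mul_of_nonneg_right hl2 (sq_nonneg (W 1))
  have hz := mul_le_mul_of_nonneg_right hl2 (sq_nonneg (W 2))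
  fin_cases k <;> simp <;> nlinarith [sq_nonneg (W 0), sq_nonneg (W 1), sq_nonneg (W 2)]

lemma blowup {l ρ : ℝ} (hρ : 0 < ρ) {L : ℕ} (u : Fin L → E 3 → (Fin 3 → ℝ))
    (hu : ∀ k, DifferentiableAt ℝ (u k) 0)
    (hQ : ∀ W ∈ Metric.ball (0 : E 3) ρ, QlamV l W = ∑ k, vecMulVec (u k W) (u k W))
    (W : E 3) (i j : Fin 3) :
    QlamV l W i j = ∑ k, (fderiv ℝ (u k) 0 W) i * (fderiv ℝ (u k) 0 W) j := by
  have hent : ∀ V ∈ Metric.ball (0 : E 3) ρ, ∀ i j,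
      QlamV l V i j = ∑ k, u k V i * u k V j := by
    intro V hV i j
    rw [hQ V hV, Matrix.sum_apply]
    simp [vecMulVec_apply]
  have hu0 : ∀ k, u k 0 = 0 := by
    intro k
    ext i
    have h := hent 0 (Metric.mem_ball_self hρ) i i
    have h0 : QlamV l 0 i i = 0 := by fin_cases i <;> simp [QlamV, Qlam]
    rw [h0] at h
    have := (Finset.sum_eq_zero_iff_of_nonneg
      (fun k _ => mul_self_nonneg (u k 0 i))).1 h.symm k (Finset.mem_univ _)
    simpa using this
  have hlim : ∀ k i, Filter.Tendsto (fun t : ℝ => t⁻¹ * u k (t • W) i)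
      (nhdsWithin 0 {0}ᶜ) (nhds ((fderiv ℝ (u k) 0 W) i)) := by
    intro k i
    have hd : HasFDerivAt (u k) (fderiv ℝ (u k) 0) ((0 : ℝ) • W) := by
      rw [zero_smul]; exact (hu k).hasFDerivAt
    have hg : HasDerivAt (fun t : ℝ => t • W) W 0 := by
      simpa using (hasDerivAt_id (0 : ℝ)).smul_const W
    have hc := hd.comp_hasDerivAt (0 : ℝ) hg
    have hs := (hasDerivAt_iff_tendsto_slope_zero.1 hc)
    have := (tendsto_pi_nhds.1 hs) i
    simpa [hu0] using this
  have hsum := tendsto_finsetSum Finset.univ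
    (fun k (_ : k ∈ Finset.univ) => (hlim k i).mul (hlim k j))
  refine tendsto_nhds_unique (Filter.Tendsto.congr' ?_ tendsto_const_nhds) hsum
  have hball : ∀ᶠ t : ℝ in nhdsWithin 0 {0}ᶜ, t • W ∈ Metric.ball (0 : E 3) ρ := by
    have hcont : Continuous (fun t : ℝ => t • W) := by fun_prop
    have := hcont.continuousAt (x := (0 : ℝ)) (Metric.isOpen_ball.mem_nhds
      (show (0 : ℝ) • W ∈ Metric.ball (0 : E 3) ρ by simpa using hρ))
    exact nhdsWithin_le_nhds this
  filter_upwards [hball, self_mem_nhdsWithin] with t ht ht0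
  have ht0 : t ≠ 0 := ht0
  have hhom : QlamV l (t • W) i j = t ^ 2 * QlamV l W i j := by
    fin_cases i <;> fin_cases j <;> simp [QlamV, Qlam] <;> ring
  have h := hent _ ht i j
  rw [hhom] at h
  have : ∑ k, t⁻¹ * u k (t • W) i * (t⁻¹ * u k (t • W) j)
      = (t⁻¹) ^ 2 * ∑ k, u k (t • W) i * u k (t • W) j := by
    rw [Finset.mul_sum]; exact Finset.sum_congr rfl fun k _ => by ring
  rw [this, ← h]
  field_simp

lemma not_sos {l : ℝ} (h2 : l < 2 / 81) {L : ℕ} (D : Fin L → E 3 →L[ℝ] (Fin 3 → ℝ))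
    (h : ∀ (W : E 3) i j, QlamV l W i j = ∑ k, (D k W) i * (D k W) j) : False := by
  set e : Fin 3 → E 3 := fun i => EuclideanSpace.single i 1 with he
  set S : Fin 3 → Fin 3 → Fin 3 → Fin 3 → ℝ :=
    fun i a j b => ∑ k, D k (e a) i * D k (e b) j with hS
  have hq : ∀ i a, S i a i a = QlamV l (e a) i i := fun i a => (h _ _ _).symm
  have hc : ∀ i j a b, S i a j b + S i b j a
      = QlamV l (e a + e b) i j - QlamV l (e a) i j - QlamV l (e b) i j := by
    intro i j a b
    rw [h, h, h]
    simp only [hS, map_add, Pi.add_apply, ← Finset.sum_add_distrib, ← Finset.sum_sub_distrib]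
    exact Finset.sum_congr rfl fun k _ => by ring
  have hpos : ∀ (s t : ℝ) i a j b,
      0 ≤ s ^ 2 * S i a i a + 2 * s * t * S i a j b + t ^ 2 * S j b j b := by
    intro s t i a j b
    have : s ^ 2 * S i a i a + 2 * s * t * S i a j b + t ^ 2 * S j b j b
        = ∑ k, (s * D k (e a) i + t * D k (e b) j) ^ 2 := by
      simp only [hS, Finset.mul_sum, ← Finset.sum_add_distrib]
      exact Finset.sum_congr rfl fun k _ => by ring
    rw [this]; positivity
  have hpos3 : 0 ≤ S 0 0 0 0 + S 1 1 1 1 + S 2 2 2 2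
      + 2 * (S 0 0 1 1 + S 0 0 2 2 + S 1 1 2 2) := by
    have : S 0 0 0 0 + S 1 1 1 1 + S 2 2 2 2 + 2 * (S 0 0 1 1 + S 0 0 2 2 + S 1 1 2 2)
        = ∑ k, (D k (e 0) 0 + D k (e 1) 1 + D k (e 2) 2) ^ 2 := by
      simp only [hS, Finset.mul_sum, ← Finset.sum_add_distrib]
      exact Finset.sum_congr rfl fun k _ => by ring
    rw [this]; positivity
  have p01 := hpos 9 1 0 1 1 0
  have p02 := hpos 1 9 0 2 2 0
  have p12 := hpos 9 1 1 2 2 1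
  have c01 := hc 0 1 0 1
  have c02 := hc 0 2 0 2
  have c12 := hc 1 2 1 2
  rw [hq, hq] at p01 p02 p12
  rw [hq, hq, hq] at hpos3
  simp [QlamV, Qlam, he] at p01 p02 p12 c01 c02 c12 hpos3
  linarith

theorem stmt_13 (l : ℝ) (h1 : 0 < l) (h2 : l < 2 / 81) :
    Subordinate (QlamV l) ∧
    (∃ c C : ℝ, 0 < c ∧ c ≤ C ∧ ∀ W : E 3,
      mLE ((c * ‖W‖ ^ 2) • (1 : Matrix (Fin 3) (Fin 3) ℝ)) (QlamV l W) ∧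
      mLE (QlamV l W) ((C * ‖W‖ ^ 2) • (1 : Matrix (Fin 3) (Fin 3) ℝ))) ∧
    ∀ δ : ℝ, 0 < δ → ∀ ρ : ℝ, 0 < ρ →
      ¬ ∃ (L : ℕ) (u : Fin L → E 3 → (Fin 3 → ℝ)),
          (∀ ℓ, CHolderOn 1 δ (u ℓ) (Metric.ball (0 : E 3) ρ)) ∧
          ∀ W ∈ Metric.ball (0 : E 3) ρ,
            QlamV l W = ∑ ℓ, vecMulVec (u ℓ W) (u ℓ W) := by
  refine ⟨sub_part h1 h2, ⟨l / 4, 3, by positivity, by linarith, ell_part h1 h2⟩, ?_⟩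
  rintro δ - ρ hρ ⟨L, u, hu, hQ⟩
  refine not_sos h2 (fun k => fderiv ℝ (u k) 0) (blowup hρ u (fun k => ?_) hQ)
  exact ((hu k).1.contDiffAt (Metric.ball_mem_nhds _ hρ)).differentiableAt (by simp)
end
end

section
/- Let 0 < β < 1 and 0 < λ < 2/81. Let φ : (−1, 1) → [0, ∞) be smooth, flat at 0, with φ(t) > 0 for t ≠ 0 and φ strictly increasing on (0, 1); let ψ : (−1, 1) → [0, ∞) be smooth with ψ(t) > 0 for t ≠ 0; and let h : ℝ → [0, ∞) be smooth with support contained in (−1, 1) and h(0) = 1. On Ω = B(0, 1) × (−1, 1) ⊂ ℝ³ × ℝ define F_{φ,ψ}(W, t) = φ(t)·Q_λ(W) + (ψ(t) + η(t, |W|))·I₃, where η(t, r) = φ(r)·h(t/r) for r > 0 and η(t, 0) = 0. Suppose there exist C_β > 0 and t₀ ∈ (0, 1) with ψ(t) ≤ C_β·φ(t)^{2/β}·|t|^{4/β} for all 0 < |t| < t₀. Then for every positive integer ν there do not exist vector fields G₁, …, G_ν : Ω → ℝ³, each of class C^{1,β} on Ω, such that F_{φ,ψ}(W, t) = Σ_{ℓ=1}^{ν}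 G_ℓ(W, t) G_ℓ(W, t)ᵀ for all (W, t) ∈ Ω. -/
open Matrix

noncomputable section

theorem aux_second_diff {X F : Type*} [NormedAddCommGroup X] [NormedSpace ℝ X]
    [NormedAddCommGroup F] [NormedSpace ℝ F] {β : ℝ} (hβ : 0 < β) (f : X → F) (U : Set X)
    (hU : IsOpen U) (hc : Convex ℝ U) (hf : ContDiffOn ℝ ((1 : ℕ) : WithTop ℕ∞) f U) (C : NNReal)
    (hC : HolderOnWith C β.toNNReal (fun x => iteratedFDerivWithin ℝ 1 f U x) U)
    (p a b : X) (h0 : p ∈ U) (h1 : p + a ∈ U) (h2 : p + b ∈ U) (h3 : p + b + a ∈ U) :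
    ‖(f (p + b + a) - f (p + b)) - (f (p + a) - f p)‖ ≤ C * ‖a‖ ^ β * ‖b‖ := by
  have hs1 : ∀ x ∈ segment ℝ p (p + b), x ∈ U := fun x hx => hc.segment_subset h0 h2 hx
  have hs2 : ∀ x ∈ segment ℝ p (p + b), x + a ∈ U := by
    intro x hx
    obtain ⟨u, v, hu, hv, huv, rfl⟩ := hx
    have : u • p + v • (p + b) + a = u • (p + a) + v • (p + b + a) := by
      have e : a = (u + v) • a := by rw [huv, one_smul]
      conv_lhs => rw [e]
      module
    rw [this]
    exact hc h1 h3 hu hv huv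
  have hd : ∀ x ∈ U, HasFDerivAt f (fderivWithin ℝ f U x) x := by
    intro x hx
    have := (hf.differentiableOn (by simp)) x hx
    exact this.hasFDerivWithinAt.hasFDerivAt (hU.mem_nhds hx)
  have key := (convex_segment (𝕜 := ℝ) p (p + b)).norm_image_sub_le_of_norm_hasFDerivWithin_le
    (f := fun x => f (x + a) - f x)
    (f' := fun x => fderivWithin ℝ f U (x + a) - fderivWithin ℝ f U x)
    (C := C * ‖a‖ ^ β) (x := p) (y := p + b) ?_ ?_ (left_mem_segment ℝ _ _)
    (right_mem_segment ℝ _ _)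
  · simpa using key
  · intro x hx
    have e1 : HasFDerivAt (fun x => f (x + a)) (fderivWithin ℝ f U (x + a)) x := by
      rw [hasFDerivAt_comp_add_right]
      exact hd _ (hs2 x hx)
    exact (e1.sub (hd x (hs1 x hx))).hasFDerivWithinAt
  · intro x hx
    have hh := hC.dist_le (hs2 x hx) (hs1 x hx)
    rw [dist_eq_norm, dist_eq_norm, Real.coe_toNNReal _ hβ.le] at hh
    simp only [add_sub_cancel_left] at hh
    refine ContinuousLinearMap.opNorm_le_bound _ (by positivity) (fun v => ?_)
    have := (iteratedFDerivWithin ℝ 1 f U (x + a) - iteratedFDerivWithin ℝ 1 f U x).le_opNorm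
      (fun _ => v)
    rw [_root_.sub_apply,
      iteratedFDerivWithin_one_apply (hU.uniqueDiffWithinAt (hs2 x hx)),
      iteratedFDerivWithin_one_apply (hU.uniqueDiffWithinAt (hs1 x hx))] at this
    simp only [Finset.univ_unique, Finset.prod_const, Finset.card_singleton, pow_one] at this
    exact this.trans (by gcongr)

theorem aux_sq (u v w z K : ℝ) (h : |u - w - (v - z)| ≤ K) :
    (u - v - w) ^ 2 ≤ 2 * K ^ 2 + 2 * z ^ 2 := by
  have key3 := sq_le_sq' (abs_le.mp h).1 (abs_le.mp h).2
  nlinarith [sq_nonneg ((u - w - (v - z)) + z)]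

theorem aux_pair {ν : ℕ} (S : ℝ) (hS : 0 < S) (ai aj bi bj ci cj : Fin ν → ℝ)
    (ha : ∑ k, ai k * aj k = 0) (hb : ∑ k, bi k * bj k = 0) (hc : ∑ k, ci k * cj k = -S)
    (hei : ∑ k, (ci k - ai k - bi k) ^ 2 ≤ 1 / 10000 * S)
    (hej : ∑ k, (cj k - aj k - bj k) ^ 2 ≤ 1 / 10000 * S)
    (hci : ∑ k, ci k * ci k ≤ 4 * S) (hcj : ∑ k, cj k * cj k ≤ 4 * S) :
    ∑ k, (ai k * bj k + aj k * bi k) ≤ - (9 / 10) * S := by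
  have : ∑ k, (ai k * bj k + aj k * bi k) ≤ ∑ k, (ci k * cj k - ai k * aj k - bi k * bj k
      + 51 * (ci k - ai k - bi k) ^ 2 + 51 * (cj k - aj k - bj k) ^ 2
      + 1 / 200 * (ci k * ci k) + 1 / 200 * (cj k * cj k)) := by
    refine Finset.sum_le_sum (fun k _ => ?_)
    generalize hx : ci k - ai k - bi k = x
    generalize hy : cj k - aj k - bj k = y
    have h1 : ci k = ai k + bi k + x := by linarith
    have h2 : cj k = aj k + bj k + y := by linarith
    have h3 : bi k = ci k - ai k - x := by linarith
    have h4 : bj k = cj k - aj k - y := by linarith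
    rw [h3, h4]
    nlinarith [sq_nonneg (100 * x + cj k), sq_nonneg (100 * y + ci k), sq_nonneg (x - y),
      sq_nonneg x, sq_nonneg y]
  simp only [Finset.sum_add_distrib, Finset.sum_sub_distrib, ← Finset.mul_sum] at this
  simp only [Finset.sum_add_distrib]
  linarith

theorem aux_final {ν : ℕ} (S l ψ : ℝ) (hS : 0 < S) (hl : l < 2 / 81) (hψ : ψ ≤ 1 / 100000 * S)
    (a b c : Fin 3 → Fin ν → ℝ)
    (a0 : ∑ k, a 0 k * a 0 k = S + ψ) (a1 : ∑ k, a 1 k * a 1 k = 2 * S + ψ)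
    (a2 : ∑ k, a 2 k * a 2 k = l * S + ψ)
    (b0 : ∑ k, b 0 k * b 0 k = l * S + ψ) (b1 : ∑ k, b 1 k * b 1 k = S + ψ)
    (b2 : ∑ k, b 2 k * b 2 k = 2 * S + ψ)
    (c0 : ∑ k, c 0 k * c 0 k = 2 * S + ψ) (c1 : ∑ k, c 1 k * c 1 k = l * S + ψ)
    (c2 : ∑ k, c 2 k * c 2 k = S + ψ)
    (hab : ∑ k, (a 0 k * b 1 k + a 1 k * b 0 k) ≤ - (9 / 10) * S)
    (hbc : ∑ k, (b 1 k * c 2 k + b 2 k * c 1 k) ≤ - (9 / 10) * S)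
    (hac : ∑ k, (a 0 k * c 2 k + a 2 k * c 0 k) ≤ - (9 / 10) * S) : False := by
  have h1 : 0 ≤ ∑ k, ((a 0 k + b 1 k + c 2 k) ^ 2 + (1 / 3 * a 1 k + 3 * b 0 k) ^ 2
    + (1 / 3 * b 2 k + 3 * c 1 k) ^ 2 + (1 / 3 * c 0 k + 3 * a 2 k) ^ 2) :=
    Finset.sum_nonneg (fun k _ => by positivity)
  have h2 : ∑ k, ((a 0 k + b 1 k + c 2 k) ^ 2 + (1 / 3 * a 1 k + 3 * b 0 k) ^ 2
    + (1 / 3 * b 2 k + 3 * c 1 k) ^ 2 + (1 / 3 * c 0 k + 3 * a 2 k) ^ 2)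
    = ∑ k, (a 0 k * a 0 k + b 1 k * b 1 k + c 2 k * c 2 k
      + 1 / 9 * (a 1 k * a 1 k) + 9 * (b 0 k * b 0 k)
      + 1 / 9 * (b 2 k * b 2 k) + 9 * (c 1 k * c 1 k)
      + 1 / 9 * (c 0 k * c 0 k) + 9 * (a 2 k * a 2 k)
      + 2 * (a 0 k * b 1 k + a 1 k * b 0 k) + 2 * (b 1 k * c 2 k + b 2 k * c 1 k)
      + 2 * (a 0 k * c 2 k + a 2 k * c 0 k)) :=
    Finset.sum_congr rfl (fun k _ => by ring)
  rw [h2] at h1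
  rw [Finset.sum_add_distrib, Finset.sum_add_distrib, Finset.sum_add_distrib,
    Finset.sum_add_distrib, Finset.sum_add_distrib, Finset.sum_add_distrib,
    Finset.sum_add_distrib, Finset.sum_add_distrib, Finset.sum_add_distrib,
    Finset.sum_add_distrib, Finset.sum_add_distrib] at h1
  simp only [← Finset.mul_sum, a0, a1, a2, b0, b1, b2, c0, c1, c2] at h1
  have := mul_lt_mul_of_pos_right hl hS
  linarith

theorem aux_norm (x y z : ℝ) (t : ℝ) (ht : 0 ≤ t) (h : x ^ 2 + y ^ 2 + z ^ 2 ≤ t ^ 2) :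
    ‖(!₂[x, y, z] : E 3)‖ ≤ t := by
  rw [EuclideanSpace.norm_eq, Fin.sum_univ_three]
  refine Real.sqrt_le_iff.mpr ⟨ht, ?_⟩
  simpa using h

theorem aux_t (β : ℝ) (hβ0 : 0 < β) (φ : ℝ → ℝ) (hc : ContinuousAt φ 0) (h0 : φ 0 = 0)
    (K C t₀ : ℝ) (ht₀ : 0 < t₀) :
    ∃ t : ℝ, 0 < t ∧ t < t₀ ∧ t < 1 ∧ φ t ≤ 1 ∧ K * (t / 2) ^ (2 * β) ≤ 1 / 100000 ∧
      4 * C * t ^ 2 ≤ 1 / 100000 := by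
  have e1 : ∀ᶠ t in nhds (0 : ℝ), φ t < 1 := by
    apply hc.eventually_lt continuousAt_const
    simp [h0]
  have e2 : ∀ᶠ t in nhds (0 : ℝ), K * (t / 2) ^ (2 * β) < 1 / 100000 := by
    have : ContinuousAt (fun t : ℝ => K * (t / 2) ^ (2 * β)) 0 := by
      refine continuousAt_const.mul ?_
      exact (continuousAt_id.div_const 2).rpow_const (Or.inr (by positivity))
    apply this.eventually_lt continuousAt_const
    rw [zero_div, Real.zero_rpow (by positivity)]
    norm_num
  have e3 : ∀ᶠ t in nhds (0 : ℝ), 4 * C * t ^ 2 < 1 / 100000 := by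
    have : ContinuousAt (fun t : ℝ => 4 * C * t ^ 2) 0 := by fun_prop
    apply this.eventually_lt continuousAt_const
    norm_num
  have e4 : ∀ᶠ t in nhds (0 : ℝ), t < t₀ := eventually_lt_nhds ht₀
  have e5 : ∀ᶠ t in nhds (0 : ℝ), t < 1 := eventually_lt_nhds one_pos
  have e := ((e1.and e2).and (e3.and (e4.and e5))).filter_mono
    (nhdsWithin_le_nhds (s := Set.Ioi (0 : ℝ)))
  obtain ⟨t, ⟨⟨h1, h2⟩, h3, h4, h5⟩, h6⟩ := (e.and self_mem_nhdsWithin).exists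
  exact ⟨t, h6, h4, h5, h1.le, h2.le, h3.le⟩

set_option maxHeartbeats 2000000

theorem stmt_16 (β l : ℝ) (hβ0 : 0 < β) (hβ1 : β < 1) (hl0 : 0 < l) (hl1 : l < 2 / 81)
    (φ ψ : ℝ → ℝ) (h : ℝ → ℝ)
    (hφsm : ContDiffOn ℝ (⊤ : ℕ∞) φ (Set.Ioo (-1 : ℝ) 1))
    (hφnn : ∀ t, 0 ≤ φ t)
    (hφflat : ∀ k : ℕ, iteratedDeriv k φ 0 = 0)
    (hφpos : ∀ t ∈ Set.Ioo (-1 : ℝ) 1, t ≠ 0 → 0 < φ t)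
    (hφmono : StrictMonoOn φ (Set.Ioo (0 : ℝ) 1))
    (hψsm : ContDiffOn ℝ (⊤ : ℕ∞) ψ (Set.Ioo (-1 : ℝ) 1))
    (hψnn : ∀ t, 0 ≤ ψ t)
    (hψpos : ∀ t ∈ Set.Ioo (-1 : ℝ) 1, t ≠ 0 → 0 < ψ t)
    (hhsm : ContDiff ℝ (⊤ : ℕ∞) h) (hhnn : ∀ t, 0 ≤ h t)
    (hhsupp : Function.support h ⊆ Set.Ioo (-1 : ℝ) 1) (hh0 : h 0 = 1)
    (Cβ t₀ : ℝ) (hCβ : 0 < Cβ) (ht₀0 : 0 < t₀) (ht₀1 : t₀ < 1)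
    (hψsmall : ∀ t : ℝ, 0 < |t| → |t| < t₀ → ψ t ≤ Cβ * φ t ^ ((2 : ℝ) / β) * |t| ^ ((4 : ℝ) / β)) :
    ∀ ν : ℕ, 0 < ν →
      ¬ ∃ G : Fin ν → (E 3 × ℝ) → (Fin 3 → ℝ),
          (∀ ℓ, CHolderOn 1 β (G ℓ) (Metric.ball (0 : E 3) 1 ×ˢ Set.Ioo (-1 : ℝ) 1)) ∧
          ∀ p ∈ Metric.ball (0 : E 3) 1 ×ˢ Set.Ioo (-1 : ℝ) 1,
            φ p.2 • QlamV l p.1 +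
                (ψ p.2 + φ ‖p.1‖ * h (p.2 / ‖p.1‖)) • (1 : Matrix (Fin 3) (Fin 3) ℝ) =
              ∑ ℓ, vecMulVec (G ℓ p) (G ℓ p) := by
  intro ν hν
  rintro ⟨G, hG, hF⟩
  have hφ0 : φ 0 = 0 := by simpa using hφflat 0
  have hφc : ContinuousAt φ 0 :=
    hφsm.continuousOn.continuousAt (Ioo_mem_nhds (by norm_num) (by norm_num))
  set U : Set (E 3 × ℝ) := Metric.ball (0 : E 3) 1 ×ˢ Set.Ioo (-1 : ℝ) 1 with hUdef
  have hU : IsOpen U := Metric.isOpen_ball.prod isOpen_Ioo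
  have hUc : Convex ℝ U := (convex_ball _ _).prod (convex_Ioo _ _)
  choose hG1 C hC using hG
  obtain ⟨t, ht0, htt, ht1, hφ1, hK, hCt⟩ := aux_t β hβ0 φ hφc hφ0 (4 * ∑ ℓ, (C ℓ : ℝ) ^ 2) Cβ t₀ ht₀0
  have htmem : t ∈ Set.Ioo (-1 : ℝ) 1 := ⟨by linarith, ht1⟩
  have hφp : 0 < φ t := hφpos t htmem ht0.ne'
  set q : ℝ := φ t ^ (1 / (2 * β)) with hq
  have hqp : 0 < q := Real.rpow_pos_of_pos hφp _
  have hq1 : q ≤ 1 := Real.rpow_le_one hφp.le hφ1 (by positivity)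
  have hqq : q ^ (2 * β) = φ t := by
    rw [hq, ← Real.rpow_mul hφp.le, one_div_mul_cancel (by positivity), Real.rpow_one]
  have hq2 : q ^ 2 = φ t ^ (1 / β) := by
    rw [hq, ← Real.rpow_natCast, ← Real.rpow_mul hφp.le]
    congr 1
    push_cast
    field_simp
  set r : ℝ := t / 2 * q with hr
  have hrp : 0 < r := by positivity
  have hrt : r ≤ t / 2 := by
    have := mul_le_mul_of_nonneg_left hq1 (by positivity : 0 ≤ t / 2)
    linarith
  set S : ℝ := φ t * r ^ 2 with hS
  have hSp : 0 < S := by positivity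
  -- smallness of ψ
  have hψS : ψ t ≤ 1 / 100000 * S := by
    have h1 := hψsmall t (abs_pos.mpr ht0.ne') (by rwa [abs_of_pos ht0])
    rw [abs_of_pos ht0] at h1
    have h2 : φ t ^ ((2 : ℝ) / β) ≤ q ^ 2 * φ t := by
      have : (2 : ℝ) / β = 1 / β + 1 / β := by ring
      rw [this, Real.rpow_add hφp, ← hq2]
      have h3 : q ^ 2 ≤ φ t := by
        rw [hq2]
        calc φ t ^ (1 / β) ≤ φ t ^ (1 : ℝ) :=
              Real.rpow_le_rpow_of_exponent_ge hφp hφ1 (by rw [le_div_iff₀ hβ0]; linarith)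
          _ = φ t := Real.rpow_one _
      exact mul_le_mul_of_nonneg_left h3 (by positivity)
    have h3 : t ^ ((4 : ℝ) / β) ≤ t ^ 4 := by
      calc t ^ ((4 : ℝ) / β) ≤ t ^ (4 : ℝ) :=
            Real.rpow_le_rpow_of_exponent_ge ht0 ht1.le (by rw [le_div_iff₀ hβ0]; linarith)
        _ = t ^ 4 := by norm_cast
    calc ψ t ≤ Cβ * φ t ^ ((2 : ℝ) / β) * t ^ ((4 : ℝ) / β) := h1
      _ ≤ Cβ * (q ^ 2 * φ t) * t ^ 4 := by gcongr
      _ = (4 * Cβ * t ^ 2) * S := by rw [hS, hr]; ring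
      _ ≤ 1 / 100000 * S := by gcongr
  -- the values of F
  have hnorm : ∀ x y z : ℝ, x ^ 2 + y ^ 2 + z ^ 2 ≤ 4 * r ^ 2 → ‖(!₂[x, y, z] : E 3)‖ ≤ t := by
    intro x y z hxyz
    refine aux_norm x y z t ht0.le ?_
    nlinarith
  have hmem : ∀ x y z : ℝ, x ^ 2 + y ^ 2 + z ^ 2 ≤ 4 * r ^ 2 →
      ((!₂[x, y, z] : E 3), t) ∈ U := by
    intro x y z hxyz
    refine ⟨?_, htmem⟩
    rw [mem_ball_zero_iff]
    exact (hnorm x y z hxyz).trans_lt ht1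
  have hval : ∀ x y z : ℝ, x ^ 2 + y ^ 2 + z ^ 2 ≤ 4 * r ^ 2 → ∀ i j : Fin 3,
      ∑ ℓ, G ℓ ((!₂[x, y, z] : E 3), t) i * G ℓ ((!₂[x, y, z] : E 3), t) j =
        φ t * Qlam l x y z i j + ψ t * (1 : Matrix (Fin 3) (Fin 3) ℝ) i j := by
    intro x y z hxyz i j
    have h1 := hF _ (hmem x y z hxyz)
    have h2 : φ ‖(!₂[x, y, z] : E 3)‖ * h (t / ‖(!₂[x, y, z] : E 3)‖) = 0 := by
      rcases (norm_nonneg (!₂[x, y, z] : E 3)).eq_or_lt with h0 | h0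
      · rw [← h0, hφ0, zero_mul]
      · have : h (t / ‖(!₂[x, y, z] : E 3)‖) = 0 := by
          by_contra hne
          have := (hhsupp hne).2
          rw [div_lt_one h0] at this
          exact absurd (hnorm x y z hxyz) (not_le.mpr this)
        rw [this, mul_zero]
    have h3 := congrFun (congrFun h1 i) j
    simp only [h2, add_zero, Matrix.add_apply, Matrix.smul_apply, Matrix.sum_apply,
      vecMulVec_apply, smul_eq_mul, QlamV] at h3
    rw [← h3]
    simp
  -- second difference
  have hzeroS : ∀ i, ∑ ℓ, (G ℓ ((!₂[0, 0, 0] : E 3), t) i) ^ 2 = ψ t := by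
    intro i
    have h1 := hval 0 0 0 (by nlinarith [sq_nonneg r]) i i
    simp only [sq]
    rw [h1]
    fin_cases i <;> simp [Qlam]
  have hsd : ∀ x y z xx yy zz : ℝ, x ^ 2 + y ^ 2 + z ^ 2 = r ^ 2 →
      xx ^ 2 + yy ^ 2 + zz ^ 2 = r ^ 2 →
      (x + xx) ^ 2 + (y + yy) ^ 2 + (z + zz) ^ 2 ≤ 4 * r ^ 2 → ∀ i : Fin 3,
      ∑ ℓ, (G ℓ ((!₂[x + xx, y + yy, z + zz] : E 3), t) i - G ℓ ((!₂[x, y, z] : E 3), t) i -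
        G ℓ ((!₂[xx, yy, zz] : E 3), t) i) ^ 2 ≤ 1 / 10000 * S := by
    intro x y z xx yy zz h1 h2 h3 i
    have hb : ∀ ℓ, (G ℓ ((!₂[x + xx, y + yy, z + zz] : E 3), t) i -
        G ℓ ((!₂[x, y, z] : E 3), t) i - G ℓ ((!₂[xx, yy, zz] : E 3), t) i) ^ 2 ≤
        2 * (C ℓ * r ^ β * r) ^ 2 + 2 * (G ℓ ((!₂[0, 0, 0] : E 3), t) i) ^ 2 := by
      intro ℓ
      have e1 : (((!₂[0, 0, 0] : E 3), t) : E 3 × ℝ) + ((!₂[x, y, z] : E 3), (0 : ℝ)) =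
          ((!₂[x, y, z] : E 3), t) := by
        refine Prod.ext ?_ (by simp)
        ext k
        fin_cases k <;> simp
      have e2 : (((!₂[0, 0, 0] : E 3), t) : E 3 × ℝ) + ((!₂[xx, yy, zz] : E 3), (0 : ℝ)) =
          ((!₂[xx, yy, zz] : E 3), t) := by
        refine Prod.ext ?_ (by simp)
        ext k
        fin_cases k <;> simp
      have e3 : (((!₂[xx, yy, zz] : E 3), t) : E 3 × ℝ) + ((!₂[x, y, z] : E 3), (0 : ℝ)) =
          ((!₂[x + xx, y + yy, z + zz] : E 3), t) := by
        refine Prod.ext ?_ (by simp)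
        ext k
        fin_cases k <;> simp [add_comm]
      have hrr : 0 ≤ r ^ 2 := by positivity
      have key := aux_second_diff hβ0 (G ℓ) U hU hUc (hG1 ℓ) (C ℓ) (hC ℓ)
        (((!₂[0, 0, 0] : E 3), t) : E 3 × ℝ) ((!₂[x, y, z] : E 3), (0 : ℝ))
        ((!₂[xx, yy, zz] : E 3), (0 : ℝ)) (hmem 0 0 0 (by linarith))
        (by rw [e1]; exact hmem _ _ _ (by linarith))
        (by rw [e2]; exact hmem _ _ _ (by linarith))
        (by rw [e2, e3]; exact hmem _ _ _ h3)
      rw [e2, e3, e1] at key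
      have n1 : ‖(((!₂[x, y, z] : E 3), (0 : ℝ)) : E 3 × ℝ)‖ ≤ r := by
        rw [Prod.norm_mk, norm_zero]
        exact max_le (aux_norm _ _ _ _ hrp.le h1.le) hrp.le
      have n2 : ‖(((!₂[xx, yy, zz] : E 3), (0 : ℝ)) : E 3 × ℝ)‖ ≤ r := by
        rw [Prod.norm_mk, norm_zero]
        exact max_le (aux_norm _ _ _ _ hrp.le h2.le) hrp.le
      have key2 := (norm_le_pi_norm _ i).trans (key.trans
        (show _ ≤ (C ℓ : ℝ) * r ^ β * r by gcongr))
      simp only [Pi.sub_apply, Real.norm_eq_abs] at key2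
      exact aux_sq _ _ _ _ _ key2
    refine (Finset.sum_le_sum (fun ℓ _ => hb ℓ)).trans ?_
    rw [Finset.sum_add_distrib, ← Finset.mul_sum, ← Finset.mul_sum, hzeroS]
    have hrb : (r ^ β) ^ 2 = (t / 2) ^ (2 * β) * φ t := by
      rw [← hqq, ← Real.mul_rpow (by positivity) hqp.le, ← hr, ← Real.rpow_natCast,
        ← Real.rpow_mul hrp.le]
      congr 1
      push_cast
      ring
    have hsum : ∑ ℓ, ((C ℓ : ℝ) * r ^ β * r) ^ 2 =
        (∑ ℓ, (C ℓ : ℝ) ^ 2) * (t / 2) ^ (2 * β) * S := by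
      rw [Finset.sum_mul, Finset.sum_mul]
      refine Finset.sum_congr rfl (fun ℓ _ => ?_)
      rw [mul_pow, mul_pow, hrb, hS]
      ring
    rw [hsum]
    have := mul_le_mul_of_nonneg_right hK hSp.le
    nlinarith
  have hψ0 := hψnn t
  have hlS : l * S ≤ 2 / 81 * S := by gcongr
  have hlS0 : 0 ≤ l * S := by positivity
  have va := hval r 0 0 (by nlinarith)
  have vb := hval 0 r 0 (by nlinarith)
  have vc := hval 0 0 r (by nlinarith)
  have vab := hval (r + 0) (0 + r) (0 + 0) (by nlinarith)
  have vbc := hval (0 + 0) (r + 0) (0 + r) (by nlinarith)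
  have vac := hval (r + 0) (0 + 0) (0 + r) (by nlinarith)
  have sab := hsd r 0 0 0 r 0 (by ring) (by ring) (by nlinarith)
  have sbc := hsd 0 r 0 0 0 r (by ring) (by ring) (by nlinarith)
  have sac := hsd r 0 0 0 0 r (by ring) (by ring) (by nlinarith)
  refine aux_final S l (ψ t) hSp hl1 hψS
    (fun i ℓ => G ℓ ((!₂[r, 0, 0] : E 3), t) i) (fun i ℓ => G ℓ ((!₂[0, r, 0] : E 3), t) i)
    (fun i ℓ => G ℓ ((!₂[0, 0, r] : E 3), t) i)
    ?_ ?_ ?_ ?_ ?_ ?_ ?_ ?_ ?_ ?_ ?_ ?_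
  · rw [va 0 0]; simp [Qlam]; linarith
  · rw [va 1 1]; simp [Qlam]; linarith
  · rw [va 2 2]; simp [Qlam]; linarith
  · rw [vb 0 0]; simp [Qlam]; linarith
  · rw [vb 1 1]; simp [Qlam]; linarith
  · rw [vb 2 2]; simp [Qlam]; linarith
  · rw [vc 0 0]; simp [Qlam]; linarith
  · rw [vc 1 1]; simp [Qlam]; linarith
  · rw [vc 2 2]; simp [Qlam]; linarith
  · refine aux_pair S hSp _ _ _ _ _ _ ?_ ?_ ?_ (sab 0) (sab 1) ?_ ?_
    · rw [va 0 1]; simp [Qlam]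
    · rw [vb 0 1]; simp [Qlam]
    · rw [vab 0 1]; simp [Qlam]; linarith
    · rw [vab 0 0]; simp [Qlam]; linarith
    · rw [vab 1 1]; simp [Qlam]; linarith
  · refine aux_pair S hSp _ _ _ _ _ _ ?_ ?_ ?_ (sbc 1) (sbc 2) ?_ ?_
    · rw [vb 1 2]; simp [Qlam]
    · rw [vc 1 2]; simp [Qlam]
    · rw [vbc 1 2]; simp [Qlam]; linarith
    · rw [vbc 1 1]; simp [Qlam]; linarith
    · rw [vbc 2 2]; simp [Qlam]; linarith
  · refine aux_pair S hSp _ _ _ _ _ _ ?_ ?_ ?_ (sac 0) (sac 2) ?_ ?_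
    · rw [va 0 2]; simp [Qlam]
    · rw [vc 0 2]; simp [Qlam]
    · rw [vac 0 2]; simp [Qlam]; linarith
    · rw [vac 0 0]; simp [Qlam]; linarith
    · rw [vac 2 2]; simp [Qlam]; linarith
end
end
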